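/- Let n ≥ 0 and k ≥ 1 be integers, and set α = j_{n+1,k} and β = j_{n,k}. Then for every real x with β/α < x < 1 one has |J_n(αx)| ≤ |J_n(α)|. -/

import Mathlib

open Real MeasureTheory intervalIntegral

/-- The Bessel function of the first kind of (integer) order `n`, defined by its
everywhere-convergent power series. -/
noncomputable def besselJ (n : ℕ) (x : ℝ) : ℝ :=
  ∑' m : ℕ, ((-1 : ℝ) ^ m / (Nat.factorial m * Nat.factorial (m + n))) * (x / 2) ^ (2 * m + n)

/-- `x` is the `k`-th positive zero of `f` (for `k ≥ 1`): `x` is a positive zero of `f`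
and there are exactly `k - 1` positive zeros of `f` below `x`. -/
def IsKthPosZero (f : ℝ → ℝ) (k : ℕ) (x : ℝ) : Prop :=
  0 < x ∧ f x = 0 ∧ {y : ℝ | 0 < y ∧ y < x ∧ f y = 0}.ncard = k - 1
/-- Coefficients of the entire function `F_n` with `J_n(x) = (x/2)^n F_n(x^2/4)`. -/
noncomputable def bc (n m : ℕ) : ℝ := (-1 : ℝ) ^ m / (Nat.factorial m * Nat.factorial (m + n))

noncomputable def bF (n : ℕ) (t : ℝ) : ℝ := ∑' m : ℕ, bc n m * t ^ m

lemma bc_abs_le (n m : ℕ) : |bc n m| ≤ 1 / (Nat.factorial m : ℝ) := by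
  unfold bc
  rw [abs_div, abs_pow, abs_neg, abs_one, one_pow, abs_of_pos (by positivity)]
  have h1 : (1 : ℝ) ≤ Nat.factorial (m + n) := by exact_mod_cast Nat.factorial_pos _
  have h2 : (0 : ℝ) < Nat.factorial m := by positivity
  gcongr
  nlinarith

lemma bc_succ (n m : ℕ) : bc n (m + 1) * ((m : ℝ) + 1) = - bc (n + 1) m := by
  unfold bc
  have h : m + 1 + n = m + (n + 1) := by ring
  rw [h, Nat.factorial_succ m, pow_succ]
  have h2 : (Nat.factorial m : ℝ) ≠ 0 := by positivity
  have h3 : (Nat.factorial (m + (n + 1)) : ℝ) ≠ 0 := by positivity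
  have h4 : ((m : ℝ) + 1) ≠ 0 := by positivity
  push_cast
  field_simp

lemma bJ_eq (n : ℕ) (x : ℝ) : besselJ n x = (x / 2) ^ n * bF n ((x / 2) ^ 2) := by
  unfold besselJ bF
  rw [← tsum_mul_left]
  refine tsum_congr fun m => ?_
  rw [pow_add, pow_mul]
  unfold bc
  ring

lemma bF_norm_summable (n : ℕ) (r : ℝ) (hr : 0 ≤ r) : Summable fun m => |bc n m| * r ^ m := by
  refine Summable.of_nonneg_of_le (fun m => by positivity) (fun m => ?_)
    (Real.summable_pow_div_factorial r)
  have := mul_le_mul_of_nonneg_right (bc_abs_le n m) (pow_nonneg hr m)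
  calc _ ≤ _ := this
    _ = _ := by ring

lemma bF_summable (n : ℕ) (t : ℝ) : Summable fun m => bc n m * t ^ m := by
  apply Summable.of_norm
  have := bF_norm_summable n |t| (abs_nonneg t)
  simpa [abs_mul, abs_pow] using this

lemma bF_hasDerivAt (n : ℕ) (t : ℝ) : HasDerivAt (bF n) (- bF (n + 1) t) t := by
  set R : ℝ := |t| + 1 with hR
  have hR0 : 0 ≤ R := by positivity
  have ht : t ∈ Metric.ball (0 : ℝ) R := by
    simp [hR]
  have key : HasDerivAt (fun z => ∑' m, bc n m * z ^ m)
      (∑' m, bc n m * ((m : ℝ) * t ^ (m - 1))) t := by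
    refine hasDerivAt_tsum_of_isPreconnected (t := Metric.ball (0 : ℝ) R) (y₀ := t)
      (g := fun m z => bc n m * z ^ m) (g' := fun m z => bc n m * ((m : ℝ) * z ^ (m - 1)))
      (u := fun m => |bc n m| * ((m : ℝ) * R ^ (m - 1))) ?_ Metric.isOpen_ball
      (convex_ball _ _).isPreconnected ?_ ?_ ht (bF_summable n t) ht
    · rw [← summable_nat_add_iff 1]
      refine (bF_norm_summable (n + 1) R hR0).congr fun m => ?_
      have h := congrArg abs (bc_succ n m)
      rw [abs_neg, abs_mul, abs_of_pos (by positivity : (0 : ℝ) < (m : ℝ) + 1)] at h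
      rw [← h]
      push_cast
      ring
    · intro m y _
      exact (hasDerivAt_pow m y).const_mul _
    · intro m y hy
      have hy' : |y| ≤ R := by
        have := Metric.mem_ball.1 hy
        rw [Real.dist_eq, sub_zero] at this
        exact this.le
      rw [Real.norm_eq_abs, abs_mul, abs_mul, abs_pow, Nat.abs_cast]
      gcongr
  have e : (∑' m, bc n m * ((m : ℝ) * t ^ (m - 1))) = - bF (n + 1) t := by
    have hs : ∀ m : ℕ, bc n (m + 1) * (((m + 1 : ℕ) : ℝ) * t ^ (m + 1 - 1))
        = - (bc (n + 1) m * t ^ m) := by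
      intro m
      have h := bc_succ n m
      push_cast
      linear_combination t ^ m * h
    have hsum : Summable fun m : ℕ => bc n m * ((m : ℝ) * t ^ (m - 1)) := by
      rw [← summable_nat_add_iff 1]
      exact (bF_summable (n + 1) t).neg.congr fun m => (hs m).symm
    rw [hsum.tsum_eq_zero_add]
    simp only [hs, tsum_neg]
    simp [bF]
  rw [e] at key
  exact key

lemma bF_analytic (n : ℕ) : AnalyticOnNhd ℝ (bF n) Set.univ := by
  have hrad : (FormalMultilinearSeries.ofScalars ℝ (bc n)).radius = ⊤ := by
    refine FormalMultilinearSeries.radius_eq_top_of_summable_norm _ fun r => ?_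
    simpa using bF_norm_summable n r r.2
  have h := (FormalMultilinearSeries.ofScalars ℝ (bc n)).hasFPowerSeriesOnBall
    (by rw [hrad]; exact ENNReal.zero_lt_top)
  have h2 := h.analyticOnNhd
  rw [hrad, Metric.eball_top] at h2
  have e : (FormalMultilinearSeries.ofScalars ℝ (bc n)).sum = bF n := by
    funext z
    have := FormalMultilinearSeries.ofScalars_sum_eq (E := ℝ) (bc n) z
    simpa [bF, FormalMultilinearSeries.ofScalarsSum] using this
  rwa [e] at h2

lemma bF_zero (n : ℕ) : bF n 0 ≠ 0 := by
  unfold bF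
  rw [tsum_eq_single 0 (by intro m hm; simp [hm])]
  simp [bc, Nat.factorial_ne_zero]

lemma bJ_zero_iff (n : ℕ) {x : ℝ} (hx : 0 < x) : besselJ n x = 0 ↔ bF n ((x / 2) ^ 2) = 0 := by
  rw [bJ_eq, mul_eq_zero, or_iff_right]
  positivity

lemma bJ_zeros_finite (n : ℕ) (a : ℝ) : {y : ℝ | 0 < y ∧ y < a ∧ besselJ n y = 0}.Finite := by
  by_contra hinf
  have hsub : {y : ℝ | 0 < y ∧ y < a ∧ besselJ n y = 0} ⊆ Set.Icc 0 a :=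
    fun y hy => ⟨hy.1.le, hy.2.1.le⟩
  obtain ⟨c, _, hc⟩ := Set.Infinite.exists_accPt_of_subset_isCompact hinf isCompact_Icc hsub
  have hfr := accPt_iff_frequently_nhdsNE.1 hc
  have han : AnalyticOnNhd ℝ (fun x : ℝ => bF n ((x / 2) ^ 2)) Set.univ := by
    intro x _
    have h1 : AnalyticAt ℝ (fun x : ℝ => (x / 2) ^ 2) x := by fun_prop
    exact (bF_analytic n _ (Set.mem_univ _)).fun_comp h1
  have h0 := han.eqOn_zero_of_preconnected_of_frequently_eq_zero isPreconnected_univ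
    (Set.mem_univ c) (hfr.mono fun y hy => (bJ_zero_iff n hy.1).1 hy.2.2)
  have := h0 (Set.mem_univ 0)
  simp only [Pi.zero_apply] at this
  norm_num at this
  exact bF_zero n this

lemma bf_hasDerivAt (n : ℕ) (x : ℝ) : HasDerivAt (fun x : ℝ => bF n ((x / 2) ^ 2))
    (- bF (n + 1) ((x / 2) ^ 2) * (x / 2)) x := by
  have h1 : HasDerivAt (fun x : ℝ => (x / 2) ^ 2) (x / 2) x := by
    have := ((hasDerivAt_id' x).div_const 2).fun_pow 2
    exact this.congr_deriv (by push_cast; ring)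
  exact (bF_hasDerivAt n _).comp x h1

/-- With `a = j (n+1) k` and `b = j n k`, for every `x` with `b/a < x < 1` one has
`|J_n(a x)| ≤ |J_n(a)|`. -/
theorem besselJ_ratio_le_one (j : ℕ → ℕ → ℝ)
    (hj : ∀ n k, 1 ≤ k → IsKthPosZero (besselJ n) k (j n k)) :
    ∀ (n k : ℕ), 1 ≤ k → ∀ x : ℝ,
      j n k / j (n + 1) k < x → x < 1 →
      |besselJ n (j (n + 1) k * x)| ≤ |besselJ n (j (n + 1) k)| := by
  intro n k hk x hx1 hx2
  obtain ⟨ha0, -, hac⟩ := hj (n + 1) k hk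
  obtain ⟨hb0, hbz, hbc⟩ := hj n k hk
  set a := j (n + 1) k
  set b := j n k
  rw [div_lt_iff₀ ha0, mul_comm] at hx1
  have hxa : a * x < a := by nlinarith
  set f : ℝ → ℝ := fun x => bF n ((x / 2) ^ 2) with hf
  have hfd : ∀ x, HasDerivAt f (- bF (n + 1) ((x / 2) ^ 2) * (x / 2)) x := bf_hasDerivAt n
  have hfc : Continuous f := continuous_iff_continuousAt.2 fun x => (hfd x).continuousAt
  -- no zero of the next Bessel function in `(b, a)`
  have hno : ∀ y, b < y → y < a → besselJ (n + 1) y ≠ 0 := by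
    have hTf := bJ_zeros_finite (n + 1) a
    have hSf := bJ_zeros_finite n b
    rw [Set.ncard_eq_toFinset_card _ hTf] at hac
    rw [Set.ncard_eq_toFinset_card _ hSf] at hbc
    set T := hTf.toFinset
    set S := hSf.toFinset
    have hbS : b ∉ S := by simp [S]
    have hcard : (insert b S).card ≤ (T.filter (· < b)).card + 1 := by
      apply Finset.card_le_of_interleaved
      have hmem : ∀ z ∈ insert b S, 0 < z ∧ z ≤ b ∧ besselJ n z = 0 := by
        intro z hz
        rcases Finset.mem_insert.1 hz with rfl | hz
        · exact ⟨hb0, le_rfl, hbz⟩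
        · have := hSf.mem_toFinset.1 hz
          exact ⟨this.1, this.2.1.le, this.2.2⟩
      intro p hp q hq hpq _
      obtain ⟨hp0, -, hpz⟩ := hmem p hp
      obtain ⟨hq0, hqb, hqz⟩ := hmem q hq
      obtain ⟨c, hc, hcz⟩ := exists_hasDerivAt_eq_zero hpq hfc.continuousOn
        (by rw [hf]; simp only; rw [(bJ_zero_iff n hp0).1 hpz, (bJ_zero_iff n hq0).1 hqz])
        (fun y _ => hfd y)
      have hc0 : 0 < c := hp0.trans hc.1
      refine ⟨c, ?_, hc.1, hc.2⟩
      refine Finset.mem_filter.2 ⟨hTf.mem_toFinset.2 ⟨hc0, by linarith [hc.2], ?_⟩,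
        by linarith [hc.2]⟩
      rw [bJ_zero_iff _ hc0]
      rcases mul_eq_zero.1 hcz with h | h
      · linarith
      · linarith
    rw [Finset.card_insert_of_notMem hbS] at hcard
    have hT : T.filter (· < b) = T :=
      Finset.eq_of_subset_of_card_le (Finset.filter_subset _ _) (by omega)
    intro y hby hya hy
    have hyT : y ∈ T := hTf.mem_toFinset.2 ⟨hb0.trans hby, hya, hy⟩
    rw [← hT] at hyT
    exact absurd (Finset.mem_filter.1 hyT).2 (not_lt.2 hby.le)
  have hfb : f b = 0 := (bJ_zero_iff n hb0).1 hbz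
  have hinj : |f (a * x)| ≤ |f a| := by
    have hba : b ∈ Set.Icc b a := ⟨le_rfl, by linarith⟩
    have haa : a ∈ Set.Icc b a := ⟨by linarith, le_rfl⟩
    have hxx : a * x ∈ Set.Icc b a := ⟨hx1.le, hxa.le⟩
    have hne : ∀ y ∈ Set.Ioo b a, - bF (n + 1) ((y / 2) ^ 2) * (y / 2) ≠ 0 := by
      intro y hy
      have hy0 : 0 < y := hb0.trans hy.1
      have := mt (bJ_zero_iff (n + 1) hy0).2 (hno y hy.1 hy.2)
      exact mul_ne_zero (neg_ne_zero.2 this) (by positivity)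
    have hsign := hasDerivWithinAt_forall_lt_or_forall_gt_of_forall_ne (convex_Ioo b a)
      (fun y _ => (hfd y).hasDerivWithinAt) hne
    rcases hsign with h | h
    · have hm : AntitoneOn f (Set.Icc b a) := by
        apply antitoneOn_of_deriv_nonpos (convex_Icc b a) hfc.continuousOn
        · exact fun y _ => (hfd y).differentiableAt.differentiableWithinAt
        · intro y hy
          rw [interior_Icc] at hy
          rw [(hfd y).deriv]
          exact (h y hy).le
      have h1 := hm hba hxx hx1.le
      have h2 := hm hxx haa hxa.le
      rw [hfb] at h1
      rw [abs_of_nonpos h1, abs_of_nonpos (h2.trans h1)]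
      linarith
    · have hm : MonotoneOn f (Set.Icc b a) := by
        apply monotoneOn_of_deriv_nonneg (convex_Icc b a) hfc.continuousOn
        · exact fun y _ => (hfd y).differentiableAt.differentiableWithinAt
        · intro y hy
          rw [interior_Icc] at hy
          rw [(hfd y).deriv]
          exact (h y hy).le
      have h1 := hm hba hxx hx1.le
      have h2 := hm hxx haa hxa.le
      rw [hfb] at h1
      rw [abs_of_nonneg h1, abs_of_nonneg (h1.trans h2)]
      exact h2
  have hx0 : 0 < a * x := hb0.trans hx1
  rw [bJ_eq, bJ_eq, abs_mul, abs_mul, abs_of_pos (by positivity : 0 < (a * x / 2) ^ n),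
    abs_of_pos (by positivity : 0 < (a / 2) ^ n)]
  exact mul_le_mul (by gcongr) hinj (abs_nonneg _) (by positivity)
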